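/- Let m = 3, N_1 ≥ N_2 ≥ N_3 ≥ 3, and r ≤ r_3, where r_3 := Ñ_1·⌊Ñ_2Ñ_3/(Ñ_1+Ñ_2+Ñ_3−2)⌋ with Ñ_1, Ñ_2, Ñ_3 the largest integers such that Ñ_1 is even, Ñ_1 ≥ Ñ_2 ≥ Ñ_3, and N_i ≥ Ñ_i for i = 1,2,3. Define h(Θ̃) := vec([[U_1, [1ᵀ;Ũ_2], [1ᵀ;Ũ_3]]]) for Θ̃ = (U_1, Ũ_2, Ũ_3) with U_1 ∈ ℝ^{N_1×r}, Ũ_2 ∈ ℝ^{(N_2−1)×r}, Ũ_3 ∈ ℝ^{(N_3−1)×r}. Then for generic Θ̃, the Jacobian matrix J_h(Θ̃) has full column rank. -/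

import Mathlib

noncomputable section

/-- Index set of the free entries of the normalized CP parameters
`Θ̃ = (U₁, Ũ₂, …, Ũ_m)`: all entries of the factor matrices except the (fixed) first rows of
the factors `2,…,m`. -/
abbrev FreeIdx (m r : ℕ) (N : Fin m → ℕ) : Type :=
  {p : Σ i : Fin m, Fin (N i) × Fin r // (p.1 : ℕ) = 0 ∨ ((p.2.1 : ℕ) ≠ 0)}

/-- Embed the normalized parameters into full factor matrices, filling the first rows of the
factors `2,…,m` with ones. -/
def embOnes {m r : ℕ} {N : Fin m → ℕ}
    (x : FreeIdx m r N → ℝ) : (i : Fin m) → Fin (N i) → Fin r → ℝ :=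
  fun i j c => if h : (i : ℕ) = 0 ∨ ((j : ℕ) ≠ 0) then x ⟨⟨i, (j, c)⟩, h⟩ else 1

/-- Entry `(i₁,…,i_m)` of the CP tensor `[[W₁,…,W_m]]`, namely `∑_{c=1}^r ∏_k W_k(i_k,c)`. -/
def cpEntry {m r : ℕ} {N : Fin m → ℕ} (W : (i : Fin m) → Fin (N i) → Fin r → ℝ)
    (idx : (i : Fin m) → Fin (N i)) : ℝ :=
  ∑ c : Fin r, ∏ i : Fin m, W i (idx i) c

/-- The (vectorized) normalized CP parametrization
`h(Θ̃) = vec([[U₁, [1ᵀ;Ũ₂], …, [1ᵀ;Ũ_m]]])`. -/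
def cpVec {m r : ℕ} {N : Fin m → ℕ} (x : FreeIdx m r N → ℝ) :
    ((i : Fin m) → Fin (N i)) → ℝ :=
  fun idx => cpEntry (embOnes x) idx

/-- Largest even integer `≤ a`. -/
def evenTrunc (a : ℕ) : ℕ := if a % 2 = 0 then a else a - 1

/-- `r₃ = Ñ₁·⌊Ñ₂Ñ₃/(Ñ₁+Ñ₂+Ñ₃−2)⌋` where `Ñ₁, Ñ₂, Ñ₃` are the largest integers with `Ñ₁` even,
`Ñ₁ ≥ Ñ₂ ≥ Ñ₃` and `N_i ≥ Ñ_i` for `i = 1,2,3` (assuming `a ≥ b ≥ c`). -/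
def rankBound3 (a b c : ℕ) : ℕ :=
  let t1 := evenTrunc a
  let t2 := min b t1
  let t3 := min c t2
  t1 * (t2 * t3 / (t1 + t2 + t3 - 2))


def dEmb {m r : ℕ} {N : Fin m → ℕ}
    (x : FreeIdx m r N → ℝ) : (i : Fin m) → Fin (N i) → Fin r → ℝ :=
  fun i j c => if h : (i : ℕ) = 0 ∨ ((j : ℕ) ≠ 0) then x ⟨⟨i, (j, c)⟩, h⟩ else 0

lemma hasFDerivAt_embOnes {m r : ℕ} {N : Fin m → ℕ} (x : FreeIdx m r N → ℝ) (i : Fin m)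
    (j : Fin (N i)) (c : Fin r) :
    ∃ L : (FreeIdx m r N → ℝ) →L[ℝ] ℝ, (∀ h, L h = dEmb h i j c) ∧
      HasFDerivAt (fun x => embOnes x i j c) L x := by
  unfold embOnes dEmb
  by_cases h : (i : ℕ) = 0 ∨ ((j : ℕ) ≠ 0)
  · simp only [h, dite_true]
    exact ⟨ContinuousLinearMap.proj _, fun _ => rfl,
      (ContinuousLinearMap.proj (R := ℝ) (φ := fun _ : FreeIdx m r N => ℝ) ⟨⟨i, (j, c)⟩, h⟩).hasFDerivAt⟩
  · simp only [h, dite_false]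
    exact ⟨0, fun _ => rfl, hasFDerivAt_const _ _⟩

lemma fderiv_cp {r : ℕ} {N : Fin 3 → ℕ} (x h : FreeIdx 3 r N → ℝ) (idx : (i : Fin 3) → Fin (N i)) :
    fderiv ℝ (cpVec (m := 3) (r := r) (N := N)) x h idx =
      ∑ c, (dEmb h 0 (idx 0) c * embOnes x 1 (idx 1) c * embOnes x 2 (idx 2) c
        + embOnes x 0 (idx 0) c * dEmb h 1 (idx 1) c * embOnes x 2 (idx 2) c
        + embOnes x 0 (idx 0) c * embOnes x 1 (idx 1) c * dEmb h 2 (idx 2) c) := by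
  choose L hL hD using fun i j c => hasFDerivAt_embOnes (m := 3) (r := r) (N := N) x i j c
  have key : HasFDerivAt (cpVec (m := 3) (r := r) (N := N))
      (ContinuousLinearMap.pi fun idx : ((i : Fin 3) → Fin (N i)) => ∑ c : Fin r,
        ((embOnes x 0 (idx 0) c * embOnes x 1 (idx 1) c) • L 2 (idx 2) c
          + embOnes x 2 (idx 2) c • (embOnes x 0 (idx 0) c • L 1 (idx 1) c
            + embOnes x 1 (idx 1) c • L 0 (idx 0) c))) x := by
    rw [hasFDerivAt_pi]
    intro idx
    simp only [cpVec, cpEntry, Fin.prod_univ_three]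
    refine HasFDerivAt.fun_sum fun c _ => ?_
    exact ((hD 0 (idx 0) c).mul (hD 1 (idx 1) c)).mul (hD 2 (idx 2) c)
  rw [key.fderiv]
  simp only [ContinuousLinearMap.pi_apply, sum_apply,
    add_apply, smul_apply, hL, smul_eq_mul]
  refine Finset.sum_congr rfl fun c _ => ?_
  ring

def PolyFn {σ : Type*} (f : (σ → ℝ) → ℝ) : Prop :=
  ∃ p : MvPolynomial σ ℝ, ∀ x, MvPolynomial.eval x p = f x

lemma PolyFn.add {σ : Type*} {f g : (σ → ℝ) → ℝ} (hf : PolyFn f) (hg : PolyFn g) :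
    PolyFn (fun x => f x + g x) := by
  obtain ⟨p, hp⟩ := hf
  obtain ⟨q, hq⟩ := hg
  exact ⟨p + q, fun x => by simp [hp, hq]⟩

lemma PolyFn.mul {σ : Type*} {f g : (σ → ℝ) → ℝ} (hf : PolyFn f) (hg : PolyFn g) :
    PolyFn (fun x => f x * g x) := by
  obtain ⟨p, hp⟩ := hf
  obtain ⟨q, hq⟩ := hg
  exact ⟨p * q, fun x => by simp [hp, hq]⟩

lemma PolyFn.const {σ : Type*} (a : ℝ) : PolyFn (fun _ : σ → ℝ => a) :=
  ⟨MvPolynomial.C a, fun x => by simp⟩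

lemma PolyFn.sum {σ ι : Type*} (s : Finset ι) {f : ι → (σ → ℝ) → ℝ} (hf : ∀ i, PolyFn (f i)) :
    PolyFn (fun x => ∑ i ∈ s, f i x) := by
  choose p hp using hf
  exact ⟨∑ i ∈ s, p i, fun x => by simp [hp]⟩

lemma PolyFn.emb {m r : ℕ} {N : Fin m → ℕ} (i : Fin m) (j : Fin (N i)) (c : Fin r) :
    PolyFn (fun x : FreeIdx m r N → ℝ => embOnes x i j c) := by
  unfold embOnes
  by_cases h : (i : ℕ) = 0 ∨ ((j : ℕ) ≠ 0)
  · simp only [h, dite_true]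
    exact ⟨MvPolynomial.X _, fun x => by simp; rfl⟩
  · simp only [h, dite_false]
    exact PolyFn.const 1

/-- Injectivity is generic in a polynomial family of linear maps. -/
lemma generic_inj {σ E m : Type*} [Fintype m] [AddCommGroup E] [Module ℝ E]
    [FiniteDimensional ℝ E] (A : (σ → ℝ) → E →ₗ[ℝ] (m → ℝ))
    (hA : ∀ e k, PolyFn (fun x => A x e k)) (x0 : σ → ℝ) (h0 : Function.Injective (A x0)) :
    ∃ P : MvPolynomial σ ℝ, P ≠ 0 ∧ ∀ x, MvPolynomial.eval x P ≠ 0 → Function.Injective (A x) := by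
  classical
  obtain ⟨B, hB⟩ := LinearMap.exists_leftInverse_of_injective (A x0) (LinearMap.ker_eq_bot.2 h0)
  let b := Module.finBasis ℝ E
  choose p hp using hA
  let M : Matrix (Fin (Module.finrank ℝ E)) (Fin (Module.finrank ℝ E)) (MvPolynomial σ ℝ) :=
    fun i j => ∑ k, MvPolynomial.C (b.repr (B (Pi.single k 1)) i) * p (b j) k
  have hM : ∀ x, MvPolynomial.eval x M.det = LinearMap.det (B ∘ₗ A x) := by
    intro x
    rw [← LinearMap.det_toMatrix b, RingHom.map_det]
    congr 1
    ext i j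
    rw [LinearMap.toMatrix_apply]
    have : A x (b j) = ∑ k, A x (b j) k • (Pi.single k (1 : ℝ) : m → ℝ) := by
      ext l
      simp [Finset.sum_apply, Pi.single_apply]
    simp only [LinearMap.comp_apply]
    conv_rhs => rw [this]
    have hMij : (MvPolynomial.eval x).mapMatrix M i j = MvPolynomial.eval x (M i j) := rfl
    rw [hMij]
    simp [M, hp, mul_comm]
  refine ⟨M.det, ?_, ?_⟩
  · intro h
    have := hM x0
    rw [h, hB] at this
    simp at this
  · intro x hx
    rw [hM] at hx
    have h1 : Function.Injective (B ∘ₗ A x) :=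
      (LinearMap.equivOfDetNeZero _ hx).injective
    rw [LinearMap.coe_comp] at h1
    exact h1.of_comp

def Good {ι J K : Type*} [Fintype ι] (t : ι → ℝ) (G : ι → Prop) (lam : (J → ℝ) →ₗ[ℝ] ℝ)
    (mu : (K → ℝ) →ₗ[ℝ] ℝ) (v : ι → J → ℝ) (w : ι → K → ℝ) : Prop :=
  ∀ (x y : ι → ℝ) (Y : ι → J → ℝ) (Z : ι → K → ℝ), (∀ i, ¬ G i → Y i = 0) →
    (∀ i, ¬ G i → Z i = 0) → (∀ i, lam (Y i) = 0) → (∀ i, mu (Z i) = 0) →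
    (∀ j k, ∑ i, (x i * v i j * w i k + (Y i j * w i k + v i j * Z i k)) = 0) →
    (∀ j k, ∑ i, (y i * v i j * w i k + t i * (Y i j * w i k + v i j * Z i k)) = 0) →
    x = 0 ∧ y = 0 ∧ Y = 0 ∧ Z = 0

lemma Good.swap {ι J K : Type*} [Fintype ι] {t : ι → ℝ} {G : ι → Prop} {lam : (J → ℝ) →ₗ[ℝ] ℝ}
    {mu : (K → ℝ) →ₗ[ℝ] ℝ} {v : ι → J → ℝ} {w : ι → K → ℝ} (h : Good t G lam mu v w) :
    Good t G mu lam w v := by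
  intro x y Y Z h1 h2 h3 h4 h5 h6
  obtain ⟨a, b, c, d⟩ := h x y Z Y h2 h1 h4 h3
    (fun j k => by
      rw [← h5 k j]; exact Finset.sum_congr rfl fun i _ => by ring)
    (fun j k => by
      rw [← h6 k j]; exact Finset.sum_congr rfl fun i _ => by ring)
  exact ⟨a, b, d, c⟩

lemma Good.lin {ι J J' K : Type*} [Fintype ι] {t : ι → ℝ} {G : ι → Prop}
    {lam : (J → ℝ) →ₗ[ℝ] ℝ} (lam' : (J' → ℝ) →ₗ[ℝ] ℝ)
    {mu : (K → ℝ) →ₗ[ℝ] ℝ} {v : ι → J → ℝ} {w : ι → K → ℝ} (h : Good t G lam mu v w)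
    (e : (J → ℝ) ≃ₗ[ℝ] (J' → ℝ)) (he : ∀ u, lam' (e u) = lam u) :
    Good t G lam' mu (fun i => e (v i)) w := by
  intro x y Y Z h1 h2 h3 h4 h5 h6
  have tr : ∀ (a c : ι → ℝ) (k : K),
      (∀ j, ∑ i, (a i * e (v i) j * w i k + c i * (Y i j * w i k + e (v i) j * Z i k)) = 0) →
      ∀ j, ∑ i, (a i * v i j * w i k + c i * (e.symm (Y i) j * w i k + v i j * Z i k)) = 0 := by
    intro a c k hh j
    have : e (∑ i, ((a i * w i k) • v i + c i • (w i k • e.symm (Y i) + Z i k • v i))) = 0 := by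
      ext j
      rw [map_sum, Finset.sum_apply, Pi.zero_apply, ← hh j]
      refine Finset.sum_congr rfl fun i _ => ?_
      simp
      ring
    rw [LinearEquiv.map_eq_zero_iff] at this
    have := congrFun this j
    rw [Finset.sum_apply, Pi.zero_apply] at this
    rw [← this]
    refine Finset.sum_congr rfl fun i _ => ?_
    simp
    ring
  obtain ⟨a, b, c, d⟩ := h x y (fun i => e.symm (Y i)) Z (fun i hi => by simp [h1 i hi]) h2
    (fun i => by rw [← he]; simp [h3]) h4
    (fun j k => by simpa using tr x (fun _ => 1) k (by simpa using fun j => h5 j k) j)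
    (fun j k => tr y t k (fun j => h6 j k) j)
  refine ⟨a, b, ?_, d⟩
  ext1 i
  have := congrFun c i
  simpa using this

lemma Good.comp {ι ι' J K : Type*} [Fintype ι] [Fintype ι'] {t' : ι' → ℝ} {G' : ι' → Prop}
    {lam : (J → ℝ) →ₗ[ℝ] ℝ}
    {mu : (K → ℝ) →ₗ[ℝ] ℝ} {v : ι' → J → ℝ} {w : ι' → K → ℝ} (h : Good t' G' lam mu v w)
    (f : ι → ι') (hf : Function.Injective f) (t : ι → ℝ) (G : ι → Prop) (hG : ∀ i, G i ↔ G' (f i))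
    (ht : ∀ i, G i → t i = t' (f i)) :
    Good t G lam mu (fun i => v (f i)) (fun i => w (f i)) := by
  classical
  intro x y Y Z h1 h2 h3 h4 h5 h6
  have hsum : ∀ F : ι' → ℝ, (∀ s, (¬ ∃ i, f i = s) → F s = 0) → ∑ s, F s = ∑ i, F (f i) := by
    intro F hF
    rw [← Finset.sum_image (s := Finset.univ) (g := f) (f := F) (fun a _ b _ hab => hf hab)]
    symm
    apply Finset.sum_subset (Finset.subset_univ _)
    intro s _ hs
    exact hF s (by simpa using hs)
  have hout : ∀ (g : ι → ℝ) s, (¬ ∃ i, f i = s) →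
      Function.extend f g 0 s = 0 := by
    intro g s hs
    rw [Function.extend_apply' _ _ _ hs]; rfl
  have houtY : ∀ s, (¬ ∃ i, f i = s) → Function.extend f Y 0 s = 0 := by
    intro s hs
    rw [Function.extend_apply' _ _ _ hs]; rfl
  have houtZ : ∀ s, (¬ ∃ i, f i = s) → Function.extend f Z 0 s = 0 := by
    intro s hs
    rw [Function.extend_apply' _ _ _ hs]; rfl
  obtain ⟨a, b, c, d⟩ := h (Function.extend f x 0) (Function.extend f y 0)
    (Function.extend f Y 0) (Function.extend f Z 0)
    (by
      intro s hs
      by_cases hs' : ∃ i, f i = s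
      · obtain ⟨i, rfl⟩ := hs'
        rw [hf.extend_apply]; exact h1 i (by rwa [hG])
      · exact houtY s hs')
    (by
      intro s hs
      by_cases hs' : ∃ i, f i = s
      · obtain ⟨i, rfl⟩ := hs'
        rw [hf.extend_apply]; exact h2 i (by rwa [hG])
      · exact houtZ s hs')
    (by
      intro s
      by_cases hs' : ∃ i, f i = s
      · obtain ⟨i, rfl⟩ := hs'
        rw [hf.extend_apply]; exact h3 i
      · rw [houtY s hs', map_zero])
    (by
      intro s
      by_cases hs' : ∃ i, f i = s
      · obtain ⟨i, rfl⟩ := hs'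
        rw [hf.extend_apply]; exact h4 i
      · rw [houtZ s hs', map_zero])
    (by
      intro j k
      rw [hsum]
      · rw [← h5 j k]
        refine Finset.sum_congr rfl fun i _ => ?_
        simp only [hf.extend_apply]
      · intro s hs
        rw [hout x s hs, houtY s hs, houtZ s hs]; simp)
    (by
      intro j k
      rw [hsum]
      · rw [← h6 j k]
        refine Finset.sum_congr rfl fun i _ => ?_
        simp only [hf.extend_apply]
        by_cases hi : G i
        · rw [ht i hi]
        · simp [h1 i hi, h2 i hi]
      · intro s hs
        rw [hout y s hs, houtY s hs, houtZ s hs]; simp)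
  refine ⟨?_, ?_, ?_, ?_⟩ <;> ext1 i
  · simpa [hf.extend_apply] using congrFun a (f i)
  · simpa [hf.extend_apply] using congrFun b (f i)
  · simpa [hf.extend_apply] using congrFun c (f i)
  · simpa [hf.extend_apply] using congrFun d (f i)

abbrev FatIdx (q : ℕ) (B C : Type) : Type := (B × C) ⊕ (Fin q × C) ⊕ (B × Fin q)

def vE {q : ℕ} {B C : Type} [DecidableEq B] :
    (Fin q × Fin 2) ⊕ FatIdx q B C → (Fin q × Fin 2) ⊕ B → ℝ
  | .inl i, .inl j => if i = j then 1 else 0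
  | .inl _, .inr _ => 0
  | .inr (.inl _), .inl _ => 0
  | .inr (.inl s), .inr b => if s.1 = b then 1 else 0
  | .inr (.inr (.inl s)), .inl j => if s.1 = j.1 then 1 / 2 else 0
  | .inr (.inr (.inl _)), .inr _ => 0
  | .inr (.inr (.inr _)), .inl _ => 0
  | .inr (.inr (.inr s)), .inr b => if s.1 = b then 1 else 0

def wE {q : ℕ} {B C : Type} [DecidableEq C] :
    (Fin q × Fin 2) ⊕ FatIdx q B C → (Fin q × Fin 2) ⊕ C → ℝ
  | .inl i, .inl j => if i = j then 1 else 0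
  | .inl _, .inr _ => 0
  | .inr (.inl _), .inl _ => 0
  | .inr (.inl s), .inr b => if s.2 = b then 1 else 0
  | .inr (.inr (.inr s)), .inl j => if s.2 = j.1 then 1 / 2 else 0
  | .inr (.inr (.inr _)), .inr _ => 0
  | .inr (.inr (.inl _)), .inl _ => 0
  | .inr (.inr (.inl s)), .inr b => if s.2 = b then 1 else 0

def sumF (J : Type*) [Fintype J] : (J → ℝ) →ₗ[ℝ] ℝ := ∑ j, LinearMap.proj j

lemma sumF_apply (J : Type*) [Fintype J] (v : J → ℝ) : sumF J v = ∑ j, v j := by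
  simp [sumF]

lemma vE_sum {q : ℕ} {B C : Type} [DecidableEq B] [Fintype B]
    (s : (Fin q × Fin 2) ⊕ FatIdx q B C) : sumF _ (vE s) = 1 := by
  rw [sumF_apply]
  rcases s with i | s | s | s <;>
    simp [vE, Fintype.sum_sum_type, Fintype.sum_prod_type, Prod.ext_iff, ite_and,
      Finset.sum_add_distrib] <;> norm_num

lemma wE_sum {q : ℕ} {B C : Type} [DecidableEq C] [Fintype C]
    (s : (Fin q × Fin 2) ⊕ FatIdx q B C) : sumF _ (wE s) = 1 := by
  rw [sumF_apply]
  rcases s with i | s | s | s <;>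
    simp [wE, Fintype.sum_sum_type, Fintype.sum_prod_type, Prod.ext_iff, ite_and,
      Finset.sum_add_distrib] <;> norm_num

lemma two_by_two {s t a b x y : ℝ} (hst : s ≠ t) (h1 : x + a = 0) (h2 : y + s * a = 0)
    (h3 : x + b = 0) (h4 : y + t * b = 0) : x = 0 ∧ y = 0 ∧ a = 0 ∧ b = 0 := by
  have hab : a = b := by linarith
  subst hab
  have : (s - t) * a = 0 := by linarith
  rcases mul_eq_zero.1 this with h | h
  · exact absurd (sub_eq_zero.1 h) hst
  · subst h
    simp at *
    simp [*]

set_option maxHeartbeats 1000000 in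
lemma good_explicit {q : ℕ} {B C : Type} [DecidableEq B] [DecidableEq C] [Fintype B] [Fintype C]
    (t : (Fin q × Fin 2) ⊕ FatIdx q B C → ℝ)
    (ht : Function.Injective fun i : Fin q × Fin 2 => t (.inl i)) :
    Good t (fun s => s.isLeft = true) (sumF _) (sumF _) vE wE := by
  intro x y Y Z h1 h2 h3 h4 h5 h6
  simp only [sumF_apply, Fintype.sum_sum_type] at h3 h4
  have Y0 : ∀ s, Y (.inr s) = 0 := fun s => h1 _ (by simp)
  have Z0 : ∀ s, Z (.inr s) = 0 := fun s => h2 _ (by simp)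
  simp only [Fintype.sum_sum_type, Y0, Z0, Pi.zero_apply, zero_mul, mul_zero, add_zero] at h5 h6
  -- corner block
  have A1 : ∀ β γ, x (.inr (.inl (β, γ))) = 0 := by
    intro β γ
    simpa [vE, wE, Fintype.sum_prod_type] using h5 (.inr β) (.inr γ)
  have A2 : ∀ β γ, y (.inr (.inl (β, γ))) = 0 := by
    intro β γ
    simpa [vE, wE, Fintype.sum_prod_type] using h6 (.inr β) (.inr γ)
  -- left blocks
  have P1 : ∀ l ε γ, x (.inr (.inr (.inl (l, γ)))) * (1/2) + Z (.inl (l, ε)) (.inr γ) = 0 := by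
    intro l ε γ
    have := h5 (.inl (l, ε)) (.inr γ)
    simp [vE, wE] at this
    simp only [Fintype.sum_prod_type] at this
    simp at this
    linarith
  have P2 : ∀ l ε γ, y (.inr (.inr (.inl (l, γ)))) * (1/2)
      + t (.inl (l, ε)) * Z (.inl (l, ε)) (.inr γ) = 0 := by
    intro l ε γ
    have := h6 (.inl (l, ε)) (.inr γ)
    simp [vE, wE] at this
    simp only [Fintype.sum_prod_type] at this
    simp at this
    linarith
  have R1 : ∀ l ε β, x (.inr (.inr (.inr (β, l)))) * (1/2) + Y (.inl (l, ε)) (.inr β) = 0 := by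
    intro l ε β
    have := h5 (.inr β) (.inl (l, ε))
    simp [vE, wE] at this
    simp only [Fintype.sum_prod_type] at this
    simp at this
    linarith
  have R2 : ∀ l ε β, y (.inr (.inr (.inr (β, l)))) * (1/2)
      + t (.inl (l, ε)) * Y (.inl (l, ε)) (.inr β) = 0 := by
    intro l ε β
    have := h6 (.inr β) (.inl (l, ε))
    simp [vE, wE] at this
    simp only [Fintype.sum_prod_type] at this
    simp at this
    linarith
  have tne : ∀ {i j : Fin q × Fin 2}, i ≠ j → t (.inl i) ≠ t (.inl j) := fun h hh => h (ht hh)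
  have P : ∀ l γ, x (.inr (.inr (.inl (l, γ)))) = 0 ∧ y (.inr (.inr (.inl (l, γ)))) = 0 ∧
      ∀ ε, Z (.inl (l, ε)) (.inr γ) = 0 := by
    intro l γ
    obtain ⟨a, b, c, d⟩ := two_by_two (tne (i := (l, 0)) (j := (l, 1)) (by simp))
      (P1 l 0 γ) (P2 l 0 γ) (P1 l 1 γ) (P2 l 1 γ)
    refine ⟨by linarith, by linarith, ?_⟩
    intro ε
    fin_cases ε
    · exact c
    · exact d
  have R : ∀ l β, x (.inr (.inr (.inr (β, l)))) = 0 ∧ y (.inr (.inr (.inr (β, l)))) = 0 ∧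
      ∀ ε, Y (.inl (l, ε)) (.inr β) = 0 := by
    intro l γ
    obtain ⟨a, b, c, d⟩ := two_by_two (tne (i := (l, 0)) (j := (l, 1)) (by simp))
      (R1 l 0 γ) (R2 l 0 γ) (R1 l 1 γ) (R2 l 1 γ)
    refine ⟨by linarith, by linarith, ?_⟩
    intro ε
    fin_cases ε
    · exact c
    · exact d
  -- main block
  have M1 : ∀ i j, (if i = j then x (.inl i) else 0) + (Y (.inl j) (.inl i) + Z (.inl i) (.inl j)) = 0 := by
    intro i j
    have := h5 (.inl i) (.inl j)
    simp [vE, wE, Finset.sum_add_distrib] at this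
    by_cases hij : i = j
    · subst hij
      simp at this ⊢
      linarith
    · simp [hij, Ne.symm hij] at this ⊢
      linarith
  have M2 : ∀ i j, (if i = j then y (.inl i) else 0) +
      (t (.inl j) * Y (.inl j) (.inl i) + t (.inl i) * Z (.inl i) (.inl j)) = 0 := by
    intro i j
    have := h6 (.inl i) (.inl j)
    simp [vE, wE, Finset.sum_add_distrib, mul_add] at this
    by_cases hij : i = j
    · subst hij
      simp at this ⊢
      linarith
    · simp [hij, Ne.symm hij] at this ⊢
      linarith
  have Off : ∀ i j, i ≠ j → Y (.inl j) (.inl i) = 0 ∧ Z (.inl i) (.inl j) = 0 := by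
    intro i j hij
    have a := M1 i j
    have b := M2 i j
    simp only [hij, if_false, zero_add] at a b
    have hc : (t (.inl j) - t (.inl i)) * Y (.inl j) (.inl i) = 0 := by
      linear_combination b - t (.inl i) * a
    rcases mul_eq_zero.1 hc with h | h
    · exact absurd (sub_eq_zero.1 h) (tne hij.symm)
    · exact ⟨h, by linarith⟩
  have DY : ∀ i, Y (.inl i) (.inl i) = 0 := by
    intro i
    have := h3 (.inl i)
    rw [Finset.sum_eq_zero (s := (Finset.univ : Finset B)) (fun β _ => (R i.1 β).2.2 i.2), add_zero,
      Finset.sum_eq_single i (fun j _ hj => (Off j i hj).1) (by simp)] at this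
    exact this
  have DZ : ∀ i, Z (.inl i) (.inl i) = 0 := by
    intro i
    have := h4 (.inl i)
    rw [Finset.sum_eq_zero (s := (Finset.univ : Finset C)) (fun β _ => (P i.1 β).2.2 i.2), add_zero,
      Finset.sum_eq_single i (fun j _ hj => (Off i j hj.symm).2) (by simp)] at this
    exact this
  refine ⟨?_, ?_, ?_, ?_⟩
  · ext1 s
    rcases s with i | ⟨β, γ⟩ | ⟨l, γ⟩ | ⟨β, l⟩
    · simpa [DY, DZ] using M1 i i
    · exact A1 _ _
    · exact (P _ _).1
    · exact (R _ _).1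
  · ext1 s
    rcases s with i | ⟨β, γ⟩ | ⟨l, γ⟩ | ⟨β, l⟩
    · simpa [DY, DZ] using M2 i i
    · exact A2 _ _
    · exact (P _ _).2.1
    · exact (R _ _).2.1
  · ext s j
    rcases s with i | s
    · rcases j with j | β
      · by_cases h : j = i
        · subst h; exact DY _
        · exact (Off _ _ h).1
      · exact (R i.1 β).2.2 i.2
    · rw [Y0]
      rfl
  · ext s j
    rcases s with i | s
    · rcases j with j | β
      · by_cases h : i = j
        · subst h; exact DZ _
        · exact (Off _ _ h).2
      · exact (P i.1 β).2.2 i.2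
    · rw [Z0]
      rfl

lemma exists_coord {J : Type} [Fintype J] {n : ℕ} (hn : 0 < n) (e : J ≃ Fin n) :
    ∃ E : (J → ℝ) ≃ₗ[ℝ] (Fin n → ℝ), ∀ u, E u ⟨0, hn⟩ = sumF J u := by
  classical
  let L : (J → ℝ) →ₗ[ℝ] (Fin n → ℝ) := LinearMap.pi fun j =>
    if j = ⟨0, hn⟩ then sumF J else LinearMap.proj (e.symm j)
  have hL : Function.Injective L := by
    rw [← LinearMap.ker_eq_bot, LinearMap.ker_eq_bot']
    intro u hu
    have h1 : ∀ j, j ≠ ⟨0, hn⟩ → u (e.symm j) = 0 := by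
      intro j hj
      have := congrFun hu j
      simpa [L, hj] using this
    have h0 : u (e.symm ⟨0, hn⟩) = 0 := by
      have := congrFun hu ⟨0, hn⟩
      simp only [L, LinearMap.pi_apply, if_true, Pi.zero_apply, sumF_apply] at this
      rw [← e.symm.sum_comp, Finset.sum_eq_single ⟨0, hn⟩ (fun j _ hj => h1 j hj) (by simp)] at this
      exact this
    ext j
    obtain ⟨j, rfl⟩ := e.symm.surjective j
    by_cases h : j = ⟨0, hn⟩
    · rw [h]; exact h0
    · exact h1 j h
  refine ⟨L.linearEquivOfInjective hL (by simp [Fintype.card_congr e]), ?_⟩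
  intro u
  rw [LinearMap.linearEquivOfInjective_apply]
  simp [L]

lemma slice_good (a q b c r g : ℕ) (hq : 0 < q) (hb : q * 2 ≤ b) (hc : q * 2 ≤ c)
    (hcount : a * (q * 2) + q * (b + c) ≤ b * c) (hr : r ≤ (a + 1) * (q * 2)) (hg : g ≤ a)
    (hb0 : 0 < b) (hc0 : 0 < c) :
    ∃ (v : Fin r → Fin b → ℝ) (w : Fin r → Fin c → ℝ), (∀ i, v i ⟨0, hb0⟩ = 1) ∧
      (∀ i, w i ⟨0, hc0⟩ = 1) ∧
      Good (fun i : Fin r => (((i : ℕ) % (q * 2) : ℕ) : ℝ)) (fun i : Fin r => (i : ℕ) / (q * 2) = g)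
        (LinearMap.proj ⟨0, hb0⟩) (LinearMap.proj ⟨0, hc0⟩) v w := by
  classical
  obtain ⟨b', rfl⟩ := Nat.exists_eq_add_of_le hb
  obtain ⟨c', rfl⟩ := Nat.exists_eq_add_of_le hc
  have hm : 0 < q * 2 := by omega
  have hcard : Fintype.card (Fin (a * (q * 2))) ≤ Fintype.card (FatIdx q (Fin b') (Fin c')) := by
    simp only [Fintype.card_sum, Fintype.card_prod, Fintype.card_fin]
    nlinarith
  obtain ⟨θ⟩ := Function.Embedding.nonempty_of_card_le hcard
  have hlow : ∀ i : ℕ, i / (q * 2) ≠ g → ¬ i < g * (q * 2) → (g + 1) * (q * 2) ≤ i := by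
    intro i h1 h2
    rw [← Nat.le_div_iff_mul_le hm]
    have : g ≤ i / (q * 2) := by rw [Nat.le_div_iff_mul_le hm]; omega
    omega
  have hga : g * (q * 2) ≤ a * (q * 2) := Nat.mul_le_mul_right _ hg
  let f : Fin r → (Fin q × Fin 2) ⊕ FatIdx q (Fin b') (Fin c') := fun i =>
    if h : (i : ℕ) / (q * 2) = g then .inl (finProdFinEquiv.symm ⟨(i : ℕ) % (q * 2), Nat.mod_lt _ hm⟩)
    else .inr (θ ⟨if (i : ℕ) < g * (q * 2) then i else i - q * 2, by
      have := i.2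
      have h3 := hlow i h
      rw [add_mul, one_mul] at hr h3
      split_ifs with h'
      · omega
      · have := h3 h'
        omega⟩)
  have hf : Function.Injective f := by
    intro i j hij
    by_cases hi : (i : ℕ) / (q * 2) = g <;> by_cases hj : (j : ℕ) / (q * 2) = g
    · simp only [f, hi, hj, dite_true, Sum.inl.injEq, EmbeddingLike.apply_eq_iff_eq, Fin.mk.injEq] at hij
      ext
      rw [← Nat.div_add_mod (i : ℕ) (q * 2), ← Nat.div_add_mod (j : ℕ) (q * 2), hi, hj, hij]
    · simp [f, hi, hj] at hij
    · simp [f, hi, hj] at hij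
    · simp only [f, hi, hj, dite_false, Sum.inr.injEq, EmbeddingLike.apply_eq_iff_eq, Fin.mk.injEq] at hij
      have h3 := hlow i hi
      have h4 := hlow j hj
      rw [add_mul, one_mul] at h3 h4
      ext
      split_ifs at hij with h5 h6 h6
      · exact hij
      · have := h4 h6
        omega
      · have := h3 h5
        omega
      · have := h3 h5
        have := h4 h6
        omega
  let t' : (Fin q × Fin 2) ⊕ FatIdx q (Fin b') (Fin c') → ℝ :=
    Sum.elim (fun s => ((finProdFinEquiv s : Fin (q * 2)) : ℕ)) 0
  have ht' : Function.Injective fun i : Fin q × Fin 2 => t' (.inl i) := by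
    intro i j hij
    simp only [t', Sum.elim_inl, Nat.cast_inj] at hij
    exact finProdFinEquiv.injective (Fin.ext hij)
  have G0 := good_explicit t' ht'
  have G1 := G0.comp f hf (fun i : Fin r => (((i : ℕ) % (q * 2) : ℕ) : ℝ))
    (fun i : Fin r => (i : ℕ) / (q * 2) = g)
    (by
      intro i
      by_cases hi : (i : ℕ) / (q * 2) = g <;> simp [f, hi])
    (by
      intro i hi
      simp only [f, hi, t', dite_true, Sum.elim_inl, Equiv.apply_symm_apply])
  obtain ⟨E1, hE1⟩ := exists_coord hb0
    ((Equiv.sumCongr finProdFinEquiv (Equiv.refl _)).trans finSumFinEquiv :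
      (Fin q × Fin 2) ⊕ Fin b' ≃ Fin (q * 2 + b'))
  obtain ⟨E2, hE2⟩ := exists_coord hc0
    ((Equiv.sumCongr finProdFinEquiv (Equiv.refl _)).trans finSumFinEquiv :
      (Fin q × Fin 2) ⊕ Fin c' ≃ Fin (q * 2 + c'))
  have G2 := (((G1.lin (LinearMap.proj (R := ℝ) (φ := fun _ : Fin _ => ℝ) ⟨0, hb0⟩) E1 hE1).swap).lin
    (LinearMap.proj (R := ℝ) (φ := fun _ : Fin _ => ℝ) ⟨0, hc0⟩) E2 hE2).swap
  exact ⟨_, _, fun i => by rw [hE1, vE_sum], fun i => by rw [hE2, wE_sum], G2⟩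

lemma generic_good {r : ℕ} {N : Fin 3 → ℕ} (t : Fin r → ℝ) (G : Fin r → Prop)
    (lam : (Fin (N 1) → ℝ) →ₗ[ℝ] ℝ) (mu : (Fin (N 2) → ℝ) →ₗ[ℝ] ℝ) (x0 : FreeIdx 3 r N → ℝ)
    (h0 : Good t G lam mu (fun c j => embOnes x0 1 j c) (fun c k => embOnes x0 2 k c)) :
    ∃ P : MvPolynomial (FreeIdx 3 r N) ℝ, P ≠ 0 ∧ ∀ x, MvPolynomial.eval x P ≠ 0 →
      Good t G lam mu (fun c j => embOnes x 1 j c) (fun c k => embOnes x 2 k c) := by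
  let E : Submodule ℝ ((Fin r → ℝ) × (Fin r → ℝ) × (Fin r → Fin (N 1) → ℝ) × (Fin r → Fin (N 2) → ℝ)) :=
    { carrier := {e | (∀ i, ¬ G i → e.2.2.1 i = 0) ∧ (∀ i, ¬ G i → e.2.2.2 i = 0) ∧
        (∀ i, lam (e.2.2.1 i) = 0) ∧ (∀ i, mu (e.2.2.2 i) = 0)}
      zero_mem' := by simp
      add_mem' := by
        rintro e f ⟨h1, h2, h3, h4⟩ ⟨g1, g2, g3, g4⟩
        refine ⟨fun i hi => ?_, fun i hi => ?_, fun i => ?_, fun i => ?_⟩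
        · simp [h1 i hi, g1 i hi]
        · simp [h2 i hi, g2 i hi]
        · simp [h3 i, g3 i]
        · simp [h4 i, g4 i]
      smul_mem' := by
        rintro a e ⟨h1, h2, h3, h4⟩
        refine ⟨fun i hi => ?_, fun i hi => ?_, fun i => ?_, fun i => ?_⟩
        · simp [h1 i hi]
        · simp [h2 i hi]
        · simp [h3 i]
        · simp [h4 i] }
  let A : (FreeIdx 3 r N → ℝ) → E →ₗ[ℝ] ((Fin (N 1) × Fin (N 2)) ⊕ (Fin (N 1) × Fin (N 2)) → ℝ) :=
    fun x =>
    { toFun := fun e => Sum.elim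
        (fun s => ∑ i, (e.1.1 i * embOnes x 1 s.1 i * embOnes x 2 s.2 i
          + (e.1.2.2.1 i s.1 * embOnes x 2 s.2 i + embOnes x 1 s.1 i * e.1.2.2.2 i s.2)))
        (fun s => ∑ i, (e.1.2.1 i * embOnes x 1 s.1 i * embOnes x 2 s.2 i
          + t i * (e.1.2.2.1 i s.1 * embOnes x 2 s.2 i + embOnes x 1 s.1 i * e.1.2.2.2 i s.2)))
      map_add' := by
        intro e f
        ext s
        rcases s with s | s <;>
        · simp only [Sum.elim_inl, Sum.elim_inr, Pi.add_apply, ← Finset.sum_add_distrib]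
          refine Finset.sum_congr rfl fun i _ => ?_
          simp
          ring
      map_smul' := by
        intro a e
        ext s
        rcases s with s | s <;>
        · simp only [Sum.elim_inl, Sum.elim_inr, Pi.smul_apply, smul_eq_mul, RingHom.id_apply,
            Finset.mul_sum]
          refine Finset.sum_congr rfl fun i _ => ?_
          simp
          ring }
  have hiff : ∀ x, Function.Injective (A x) ↔
      Good t G lam mu (fun c j => embOnes x 1 j c) (fun c k => embOnes x 2 k c) := by
    intro x
    rw [← LinearMap.ker_eq_bot, LinearMap.ker_eq_bot']
    constructor
    · intro h X Y Z W h1 h2 h3 h4 h5 h6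
      have := h ⟨(X, Y, Z, W), h1, h2, h3, h4⟩ (by
        ext s
        rcases s with s | s
        · exact h5 s.1 s.2
        · exact h6 s.1 s.2)
      simpa [Subtype.ext_iff] using this
    · rintro h ⟨⟨X, Y, Z, W⟩, h1, h2, h3, h4⟩ h5
      obtain ⟨a, b, c, d⟩ := h X Y Z W h1 h2 h3 h4 (fun j k => congrFun h5 (.inl (j, k)))
        (fun j k => congrFun h5 (.inr (j, k)))
      simp [Subtype.ext_iff, a, b, c, d]
  obtain ⟨P, hP, hP'⟩ := generic_inj A (by
    intro e s
    rcases s with s | s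
    · show PolyFn fun x => ∑ i, (e.1.1 i * embOnes x 1 s.1 i * embOnes x 2 s.2 i
          + (e.1.2.2.1 i s.1 * embOnes x 2 s.2 i + embOnes x 1 s.1 i * e.1.2.2.2 i s.2))
      refine PolyFn.sum _ fun i => ?_
      exact (((PolyFn.const _).mul (PolyFn.emb _ _ _)).mul (PolyFn.emb _ _ _)).add
        (((PolyFn.const _).mul (PolyFn.emb _ _ _)).add ((PolyFn.emb _ _ _).mul (PolyFn.const _)))
    · show PolyFn fun x => ∑ i, (e.1.2.1 i * embOnes x 1 s.1 i * embOnes x 2 s.2 i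
          + t i * (e.1.2.2.1 i s.1 * embOnes x 2 s.2 i + embOnes x 1 s.1 i * e.1.2.2.2 i s.2))
      refine PolyFn.sum _ fun i => ?_
      exact (((PolyFn.const _).mul (PolyFn.emb _ _ _)).mul (PolyFn.emb _ _ _)).add
        ((PolyFn.const _).mul
        (((PolyFn.const _).mul (PolyFn.emb _ _ _)).add ((PolyFn.emb _ _ _).mul (PolyFn.const _)))))
    x0 ((hiff x0).2 h0)
  exact ⟨P, hP, fun x hx => (hiff x).1 (hP' x hx)⟩

lemma exists_point {r : ℕ} (N : Fin 3 → ℕ) (a q : ℕ) (hq : 0 < q) (hb : q * 2 ≤ N 1)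
    (hc : q * 2 ≤ N 2) (hcount : a * (q * 2) + q * (N 1 + N 2) ≤ N 1 * N 2)
    (hr : r ≤ (a + 1) * (q * 2)) (hb0 : 0 < N 1) (hc0 : 0 < N 2) :
    ∃ x : FreeIdx 3 r N → ℝ, ∀ g ≤ a,
      Good (fun i : Fin r => (((i : ℕ) % (q * 2) : ℕ) : ℝ)) (fun i : Fin r => (i : ℕ) / (q * 2) = g)
        (LinearMap.proj ⟨0, hb0⟩) (LinearMap.proj ⟨0, hc0⟩)
        (fun c j => embOnes x 1 j c) (fun c k => embOnes x 2 k c) := by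
  have key : ∀ g : Fin (a + 1), ∃ P : MvPolynomial (FreeIdx 3 r N) ℝ, P ≠ 0 ∧
      ∀ x, MvPolynomial.eval x P ≠ 0 →
      Good (fun i : Fin r => (((i : ℕ) % (q * 2) : ℕ) : ℝ)) (fun i : Fin r => (i : ℕ) / (q * 2) = g)
        (LinearMap.proj ⟨0, hb0⟩) (LinearMap.proj ⟨0, hc0⟩)
        (fun c j => embOnes x 1 j c) (fun c k => embOnes x 2 k c) := by
    intro g
    obtain ⟨v, w, hv, hw, hG⟩ := slice_good a q (N 1) (N 2) r g hq hb hc hcount hr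
      (Nat.lt_succ_iff.1 g.2) hb0 hc0
    let x0 : FreeIdx 3 r N → ℝ := fun p => match p with
      | ⟨⟨0, _⟩, _⟩ => 0
      | ⟨⟨1, j, c⟩, _⟩ => v c j
      | ⟨⟨2, k, c⟩, _⟩ => w c k
    refine generic_good _ _ _ _ x0 ?_
    have e1 : (fun (c : Fin r) (j : Fin (N 1)) => embOnes x0 1 j c) = v := by
      ext c j
      by_cases h : (j : ℕ) = 0
      · have : j = ⟨0, hb0⟩ := Fin.ext h
        subst this
        simp [embOnes, hv]
      · simp [embOnes, h, x0]
    have e2 : (fun (c : Fin r) (j : Fin (N 2)) => embOnes x0 2 j c) = w := by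
      ext c j
      by_cases h : (j : ℕ) = 0
      · have : j = ⟨0, hc0⟩ := Fin.ext h
        subst this
        simp [embOnes, hw]
      · simp [embOnes, h, x0]
    rw [e1, e2]
    exact hG
  choose P hP hP' using key
  have hprod : ∏ g, P g ≠ 0 := Finset.prod_ne_zero_iff.2 fun g _ => hP g
  have : ∃ x, MvPolynomial.eval x (∏ g, P g) ≠ 0 := by
    by_contra! h
    exact hprod (MvPolynomial.funext fun x => by simpa using h x)
  obtain ⟨x, hx⟩ := this
  rw [map_prod, Finset.prod_ne_zero_iff] at hx
  refine ⟨x, fun g hg => ?_⟩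
  exact hP' ⟨g, Nat.lt_succ_iff.2 hg⟩ x (hx _ (Finset.mem_univ _))

lemma exists_inj {r : ℕ} (N : Fin 3 → ℕ) (a q : ℕ) (hq : 0 < q) (hb : q * 2 ≤ N 1)
    (hc : q * 2 ≤ N 2) (hcount : a * (q * 2) + q * (N 1 + N 2) ≤ N 1 * N 2)
    (hr : r ≤ (a + 1) * (q * 2)) (ha : 2 * (a + 1) ≤ N 0) :
    ∃ x : FreeIdx 3 r N → ℝ, Function.Injective (fderiv ℝ (cpVec (m := 3) (r := r) (N := N)) x) := by
  classical
  have hb0 : 0 < N 1 := by omega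
  have hc0 : 0 < N 2 := by omega
  obtain ⟨x1, hx1⟩ := exists_point N a q hq hb hc hcount hr hb0 hc0
  let u : ℕ → ℕ → ℝ := fun α c => if c / (q * 2) = α / 2 then
    (if α % 2 = 0 then 1 else ((c % (q * 2) : ℕ) : ℝ)) else 0
  let x0 : FreeIdx 3 r N → ℝ := fun p =>
    if (p.1.1 : ℕ) = 0 then u p.1.2.1 p.1.2.2 else x1 p
  have e0 : ∀ α c, embOnes x0 0 α c = u α c := by
    intro α c
    simp [embOnes, x0]
  have e1 : ∀ j c, embOnes x0 1 j c = embOnes x1 1 j c := by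
    intro α c
    simp [embOnes, x0]
  have e2 : ∀ j c, embOnes x0 2 j c = embOnes x1 2 j c := by
    intro α c
    simp [embOnes, x0]
  have d1 : ∀ (h : FreeIdx 3 r N → ℝ) c, dEmb h 1 ⟨0, hb0⟩ c = 0 := by
    intro h c
    simp [dEmb]
  have d2 : ∀ (h : FreeIdx 3 r N → ℝ) c, dEmb h 2 ⟨0, hc0⟩ c = 0 := by
    intro h c
    simp [dEmb]
  refine ⟨x0, ?_⟩
  rw [injective_iff_map_eq_zero]
  intro h hh
  have eq : ∀ (α : Fin (N 0)) (j : Fin (N 1)) (k : Fin (N 2)),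
      ∑ c : Fin r, (dEmb h 0 α c * embOnes x1 1 j c * embOnes x1 2 k c
        + u α c * (dEmb h 1 j c * embOnes x1 2 k c + embOnes x1 1 j c * dEmb h 2 k c)) = 0 := by
    intro α j k
    have := fderiv_cp x0 h (fun i => match i with
      | 0 => α
      | 1 => j
      | 2 => k)
    rw [hh] at this
    simp only [e0, e1, e2] at this
    rw [Pi.zero_apply] at this
    rw [this]
    refine Finset.sum_congr rfl fun c _ => ?_
    ring
  have main : ∀ g (hg : g ≤ a), (∀ c, dEmb h 0 ⟨2 * g, by omega⟩ c = 0) ∧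
      (∀ c, dEmb h 0 ⟨2 * g + 1, by omega⟩ c = 0) ∧
      (∀ c : Fin r, (c : ℕ) / (q * 2) = g → ∀ j, dEmb h 1 j c = 0) ∧
      (∀ c : Fin r, (c : ℕ) / (q * 2) = g → ∀ j, dEmb h 2 j c = 0) := by
    intro g hg
    obtain ⟨p1, p2, p3, p4⟩ := hx1 g hg (fun c => dEmb h 0 ⟨2 * g, by omega⟩ c)
      (fun c => dEmb h 0 ⟨2 * g + 1, by omega⟩ c)
      (fun c j => if (c : ℕ) / (q * 2) = g then dEmb h 1 j c else 0)
      (fun c j => if (c : ℕ) / (q * 2) = g then dEmb h 2 j c else 0)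
      (fun i hi => by ext; simp [hi]) (fun i hi => by ext; simp [hi])
      (fun i => by simp [d1]) (fun i => by simp [d2])
      (fun j k => by
        refine Eq.trans ?_ (eq ⟨2 * g, by omega⟩ j k)
        refine Finset.sum_congr rfl fun c _ => ?_
        by_cases hcg : (c : ℕ) / (q * 2) = g <;> simp [u, hcg])
      (fun j k => by
        refine Eq.trans ?_ (eq ⟨2 * g + 1, by omega⟩ j k)
        refine Finset.sum_congr rfl fun c _ => ?_
        have hg2 : (2 * g + 1) / 2 = g := by omega
        have hg3 : (2 * g + 1) % 2 ≠ 0 := by omega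
        by_cases hcg : (c : ℕ) / (q * 2) = g <;> simp [u, hcg, hg2])
    refine ⟨fun c => congrFun p1 c, fun c => congrFun p2 c, fun c hc j => ?_, fun c hc j => ?_⟩
    · simpa [hc] using congrFun (congrFun p3 c) j
    · simpa [hc] using congrFun (congrFun p4 c) j
  have hgrp : ∀ c : Fin r, (c : ℕ) / (q * 2) ≤ a := by
    intro c
    have : (c : ℕ) / (q * 2) < a + 1 := by
      rw [Nat.div_lt_iff_lt_mul (by omega)]
      omega
    omega
  have h1 : ∀ j c, dEmb h 1 j c = 0 := fun j c => (main _ (hgrp c)).2.2.1 c rfl j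
  have h2 : ∀ j c, dEmb h 2 j c = 0 := fun j c => (main _ (hgrp c)).2.2.2 c rfl j
  have h0 : ∀ j c, dEmb h 0 j c = 0 := by
    intro j c
    obtain ⟨p1, -⟩ := hx1 0 (Nat.zero_le _) (fun c => dEmb h 0 j c) 0 0 0
      (by simp) (by simp) (by simp) (by simp)
      (fun j' k => by
        refine Eq.trans ?_ (eq j j' k)
        refine Finset.sum_congr rfl fun c _ => ?_
        simp [h1, h2])
      (by simp)
    exact congrFun p1 c
  ext p
  obtain ⟨⟨i, j, c⟩, hp⟩ := p
  have hall : dEmb h i j c = 0 := by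
    fin_cases i
    · exact h0 j c
    · exact h1 j c
    · exact h2 j c
  have : dEmb h i j c = h ⟨⟨i, j, c⟩, hp⟩ := by
    unfold dEmb
    exact dif_pos hp
  rw [← this, hall]; rfl

lemma generic_final {r : ℕ} (N : Fin 3 → ℕ) (x0 : FreeIdx 3 r N → ℝ)
    (h0 : Function.Injective (fderiv ℝ (cpVec (m := 3) (r := r) (N := N)) x0)) :
    ∃ P : MvPolynomial (FreeIdx 3 r N) ℝ, P ≠ 0 ∧ ∀ x, MvPolynomial.eval x P ≠ 0 →
      Function.Injective (fderiv ℝ (cpVec (m := 3) (r := r) (N := N)) x) := by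
  refine generic_inj (fun x => (fderiv ℝ (cpVec (m := 3) (r := r) (N := N)) x).toLinearMap) ?_ x0 h0
  intro e k
  simp only [ContinuousLinearMap.coe_coe, fderiv_cp]
  refine PolyFn.sum _ fun c => ?_
  exact ((((PolyFn.const _).mul (PolyFn.emb _ _ _)).mul (PolyFn.emb _ _ _)).add
    (((PolyFn.emb _ _ _).mul (PolyFn.const _)).mul (PolyFn.emb _ _ _))).add
    (((PolyFn.emb _ _ _).mul (PolyFn.emb _ _ _)).mul (PolyFn.const _))

/-- Let `m = 3`, `N₁ ≥ N₂ ≥ N₃ ≥ 3`, and `r ≤ r₃`.  Then for generic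
`Θ̃ = (U₁, Ũ₂, Ũ₃)` the Jacobian of `h(Θ̃) = vec([[U₁, [1ᵀ;Ũ₂], [1ᵀ;Ũ₃]]])` has full
column rank (is injective as a linear map). -/
theorem cp_jacobian_full_rank_order3
    (N₁ N₂ N₃ r : ℕ) (h12 : N₂ ≤ N₁) (h23 : N₃ ≤ N₂) (h3 : 3 ≤ N₃)
    (hr : r ≤ rankBound3 N₁ N₂ N₃) :
    ∃ P : MvPolynomial (FreeIdx 3 r ![N₁, N₂, N₃]) ℝ, P ≠ 0 ∧
      ∀ x : FreeIdx 3 r ![N₁, N₂, N₃] → ℝ,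
        MvPolynomial.eval x P ≠ 0 →
        Function.Injective (fderiv ℝ (cpVec (m := 3) (r := r) (N := ![N₁, N₂, N₃])) x) := by

  suffices hx : ∃ x : FreeIdx 3 r ![N₁, N₂, N₃] → ℝ,
      Function.Injective (fderiv ℝ (cpVec (m := 3) (r := r) (N := ![N₁, N₂, N₃])) x) by
    obtain ⟨x, hx⟩ := hx
    exact generic_final _ x hx
  rcases Nat.eq_zero_or_pos r with h0 | hrpos
  · subst h0
    have : IsEmpty (FreeIdx 3 0 ![N₁, N₂, N₃]) := ⟨fun p => p.1.2.2.elim0⟩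
    exact ⟨0, Function.injective_of_subsingleton _⟩
  have ht1 : ∃ a, evenTrunc N₁ = 2 * (a + 1) ∧ 2 * (a + 1) ≤ N₁ ∧ N₁ ≤ 2 * (a + 1) + 1 := by
    refine ⟨N₁ / 2 - 1, ?_, ?_, ?_⟩
    · unfold evenTrunc
      split_ifs <;> omega
    · omega
    · omega
  obtain ⟨a, ha, ha1, ha2⟩ := ht1
  simp only [rankBound3, ha] at hr
  obtain ⟨t2, ht2⟩ : ∃ t2, t2 = min N₂ (2 * (a + 1)) := ⟨_, rfl⟩
  rw [← ht2] at hr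
  obtain ⟨t3, ht3⟩ : ∃ t3, t3 = min N₃ t2 := ⟨_, rfl⟩
  rw [← ht3] at hr
  obtain ⟨q, hq⟩ : ∃ q, q = t2 * t3 / (2 * (a + 1) + t2 + t3 - 2) := ⟨_, rfl⟩
  rw [← hq] at hr
  have hq0 : 0 < q := by
    rcases Nat.eq_zero_or_pos q with h | h
    · rw [h] at hr; omega
    · exact h
  have hmul : q * (2 * a + t2 + t3) ≤ t2 * t3 := by
    have : 2 * (a + 1) + t2 + t3 - 2 = 2 * a + t2 + t3 := by omega
    rw [this] at hq
    rw [hq]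
    exact Nat.div_mul_le_self _ _
  have hq3 : q * 2 ≤ t3 := by
    have h1 : t2 ≤ 2 * a + t3 := by omega
    have h2 : q * (2 * t2) ≤ t2 * t3 := le_trans (Nat.mul_le_mul_left _ (by omega)) hmul
    have h3 : 0 < t2 := by omega
    refine Nat.le_of_mul_le_mul_left ?_ h3
    nlinarith
  obtain ⟨d, hd⟩ := Nat.exists_eq_add_of_le (show t2 ≤ N₂ by omega)
  obtain ⟨e, he⟩ := Nat.exists_eq_add_of_le (show t3 ≤ N₃ by omega)
  have hq2 : q ≤ t2 := by omega
  have hq3' : q ≤ t3 := by omega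
  refine exists_inj ![N₁, N₂, N₃] a q hq0 ?_ ?_ ?_ ?_ ?_
  · show q * 2 ≤ N₂
    omega
  · show q * 2 ≤ N₃
    omega
  · show a * (q * 2) + q * (N₂ + N₃) ≤ N₂ * N₃
    rw [hd, he]
    nlinarith [Nat.mul_le_mul_right d hq3', Nat.mul_le_mul_right e hq2, Nat.zero_le (d * e)]
  · calc r ≤ _ := hr
      _ = _ := by ring
  · exact ha1
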